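/- Suppose U(x) = (x−1)^4 V(x) is a monic real polynomial of degree 8, where V is a monic real polynomial of degree 4 with no real roots, and U defines the sign pattern (+,−,−,+,−,+,−,+,+). Then there exist a real number t > 0 and real numbers S > 0, M, N with N ≥ M^2/4 such that U(x) + t x (x−1)^4 = (x−1)^4 (x^2 + Sx + S^2/4)(x^2 + Mx + N) and the polynomial U(x) + t x (x−1)^4 defines the sign pattern (+,−,−,+,−,+,−,+,+). -/

import Mathlib

open Polynomial

/-- A degree-8 real polynomial `P` defines the sign pattern `σ = (σ_0, …, σ_8)`
(with entries `1` for `+`, `-1` for `−`) if for each `j` the coefficient of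
`x^(8-j)` is nonzero and has sign `σ_j`. -/
def definesSignPattern (P : Polynomial ℝ) (σ : Fin 9 → ℝ) : Prop :=
  ∀ j : Fin 9, Real.sign (P.coeff (8 - (j : ℕ))) = σ j

/-- A monic quartic function without real roots, positive at `0`, is tangent from above to
a line `y = -t x` with `t > 0` at a negative abscissa `-y`. -/
lemma exists_tangent_of_pos {a b c d : ℝ}
    (hpos : ∀ x : ℝ, 0 < x ^ 4 + a * x ^ 3 + b * x ^ 2 + c * x + d) :
    ∃ t y : ℝ, 0 < t ∧ 0 < y ∧ y ^ 4 - a * y ^ 3 + b * y ^ 2 - (c + t) * y + d = 0 ∧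
      ∀ x : ℝ, 0 ≤ x ^ 4 + a * x ^ 3 + b * x ^ 2 + (c + t) * x + d := by
  set f : ℝ → ℝ := fun y => y ^ 4 - a * y ^ 3 + b * y ^ 2 - c * y + d with hf
  have hfpos : ∀ y, 0 < f y := fun y => by
    have := hpos (-y)
    simp only [hf]
    linarith [this]
  have hd : 0 < d := by simpa [hf] using hfpos 0
  have hfc : Continuous f := by fun_prop
  set K := f 1 with hK
  have hnear : ∀ᶠ y in nhds (0 : ℝ), 0 < f y - K * y :=
    (show Continuous fun y => f y - K * y by fun_prop).continuousAt.eventually_const_lt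
      (by simpa [hf] using hd)
  obtain ⟨δ, hδ, hδf⟩ := Metric.eventually_nhds_iff.1 hnear
  set R := 1 + |a| + |b| + |c + K| with hR
  have hfar : ∀ y, R ≤ y → 0 < f y - K * y := by
    intro y hy
    have ha := abs_nonneg a
    have hb := abs_nonneg b
    have hc := abs_nonneg (c + K)
    have hy1 : 1 ≤ y := by linarith
    have h3 : 0 < y ^ 3 := by positivity
    have h23 : y ^ 2 ≤ y ^ 3 := pow_le_pow_right₀ hy1 (by norm_num)
    have h13 : y ≤ y ^ 3 := le_self_pow₀ hy1 (by norm_num)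
    have e1 : a * y ^ 3 ≤ |a| * y ^ 3 := by gcongr; exact le_abs_self a
    have e2 : -b * y ^ 2 ≤ |b| * y ^ 3 := by
      have := neg_le_abs b
      have : -b * y ^ 2 ≤ |b| * y ^ 2 := by gcongr
      have : |b| * y ^ 2 ≤ |b| * y ^ 3 := by gcongr
      linarith
    have e3 : (c + K) * y ≤ |c + K| * y ^ 3 := by
      have := le_abs_self (c + K)
      have : (c + K) * y ≤ |c + K| * y := by gcongr
      have : |c + K| * y ≤ |c + K| * y ^ 3 := by gcongr
      linarith
    have e4 : R * y ^ 3 ≤ y * y ^ 3 := by gcongr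
    simp only [hf]
    rw [hR] at e4
    nlinarith
  have hR1 : 1 ≤ R := by
    have ha := abs_nonneg a
    have hb := abs_nonneg b
    have hc := abs_nonneg (c + K)
    linarith
  set ε := min δ 1 / 2 with hε
  have hε0 : 0 < ε := by positivity
  have hε1 : ε ≤ 1 := by linarith [min_le_right δ 1]
  have hεδ : ε < δ := by
    have := min_le_left δ 1
    linarith
  obtain ⟨y, hy, hmin⟩ := isCompact_Icc.exists_isMinOn (s := Set.Icc ε R)
    (f := fun y => f y / y) ⟨1, hε1, hR1⟩
    (hfc.continuousOn.div continuousOn_id fun z hz => (hε0.trans_le hz.1).ne')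
  have hy0 : 0 < y := hε0.trans_le hy.1
  have htK : f y / y ≤ K := by
    simpa [hK] using hmin (show (1 : ℝ) ∈ Set.Icc ε R from ⟨hε1, hR1⟩)
  have hline : ∀ z, 0 < z → f y / y * z ≤ f z := by
    intro z hz
    have hKz : f y / y * z ≤ K * z := by gcongr
    rcases lt_or_ge z ε with h | h
    · have := hδf (y := z) (by rw [Real.dist_eq, sub_zero, abs_of_pos hz]; linarith)
      linarith
    rcases le_or_gt z R with h' | h'
    · exact (le_div_iff₀ hz).1 (hmin ⟨h, h'⟩)
    · linarith [hfar z h'.le]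
  have ht : 0 < f y / y := div_pos (hfpos y) hy0
  refine ⟨f y / y, y, ht, hy0, ?_, fun x => ?_⟩
  · have : f y / y * y = f y := div_mul_cancel₀ _ hy0.ne'
    have : f y = y ^ 4 - a * y ^ 3 + b * y ^ 2 - c * y + d := rfl
    linarith
  · rcases lt_or_ge x 0 with h | h
    · have h1 := hline (-x) (by linarith)
      have : f (-x) = (-x) ^ 4 - a * (-x) ^ 3 + b * (-x) ^ 2 - c * (-x) + d := rfl
      linarith
    · have := mul_nonneg ht.le h
      linarith [hpos x]

/-- A nonnegative monic quartic function with a root `-y`, `y > 0`, and a positive constant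
term is `(x + y) ^ 2` times a nonnegative monic quadratic. -/
lemma exists_factor_of_nonneg {a b c d y : ℝ} (hy : 0 < y) (hd : 0 < d)
    (hroot : y ^ 4 - a * y ^ 3 + b * y ^ 2 - c * y + d = 0)
    (hnonneg : ∀ x : ℝ, 0 ≤ x ^ 4 + a * x ^ 3 + b * x ^ 2 + c * x + d) :
    ∃ M N : ℝ, M ^ 2 / 4 ≤ N ∧ a = M + 2 * y ∧ b = N + 2 * y * M + y ^ 2 ∧
      c = 2 * y * N + y ^ 2 * M ∧ d = y ^ 2 * N := by
  have hder : HasDerivAt (fun x : ℝ => x ^ 4 + a * x ^ 3 + b * x ^ 2 + c * x + d)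
      (4 * (-y) ^ 3 + a * (3 * (-y) ^ 2) + b * (2 * (-y)) + c) (-y) := by
    have h := ((((hasDerivAt_pow 4 (-y)).add ((hasDerivAt_pow 3 (-y)).const_mul a)).add
      ((hasDerivAt_pow 2 (-y)).const_mul b)).add ((hasDerivAt_id (-y)).const_mul c)).add_const d
    refine HasDerivAt.congr_deriv h ?_
    norm_num
  have hmin : IsLocalMin (fun x : ℝ => x ^ 4 + a * x ^ 3 + b * x ^ 2 + c * x + d) (-y) :=
    Filter.Eventually.of_forall fun x => by
      have := hnonneg x
      linarith
  have h0 := hmin.hasDerivAt_eq_zero hder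
  set M := a - 2 * y with hM
  set N := b + 3 * y ^ 2 - 2 * y * a with hN
  have hc : c = 2 * y * N + y ^ 2 * M := by linear_combination h0
  have hdN : d = y ^ 2 * N := by linear_combination hroot + y * h0
  have hNpos : 0 < N := pos_of_mul_pos_right (hdN ▸ hd) (by positivity)
  have hfac : ∀ x, 0 ≤ (x + y) ^ 2 * (x ^ 2 + M * x + N) := by
    intro x
    convert hnonneg x using 1
    rw [hdN, hc, hM, hN]
    ring
  have hquad : ∀ x, x ≠ -y → 0 ≤ x ^ 2 + M * x + N := by
    intro x hx
    have : x + y ≠ 0 := fun h => hx (by linarith)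
    exact nonneg_of_mul_nonneg_right (hfac x) (by positivity)
  refine ⟨M, N, ?_, by rw [hM]; ring, by rw [hM, hN]; ring, hc, hdN⟩
  by_cases hMy : M = 2 * y
  · rw [hMy]
    by_contra! h
    have hlt : 0 < y ^ 2 - N := by linarith
    set e := (y ^ 2 - N) / (2 * y) with he
    have he0 : 0 < e := by positivity
    have hey : 2 * y * e = y ^ 2 - N := by rw [he]; field_simp
    have := hquad (-y + e) (by linarith)
    rw [hMy] at this
    nlinarith
  · have := hquad (-M / 2) fun h => hMy (by linarith)
    linarith

/-- The expansion of `(X - 1) ^ 4` times a monic quartic polynomial. -/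
lemma X_sub_one_pow_four_mul (a b c d : ℝ) :
    (X - 1 : ℝ[X]) ^ 4 * (X ^ 4 + C a * X ^ 3 + C b * X ^ 2 + C c * X + C d) =
      X ^ 8 + C (a - 4) * X ^ 7 + C (b - 4 * a + 6) * X ^ 6 + C (c - 4 * b + 6 * a - 4) * X ^ 5 +
        C (d - 4 * c + 6 * b - 4 * a + 1) * X ^ 4 + C (-4 * d + 6 * c - 4 * b + a) * X ^ 3 +
        C (6 * d - 4 * c + b) * X ^ 2 + C (-4 * d + c) * X + C d := by
  simp only [map_add, map_sub, map_mul, map_neg, map_ofNat, map_one]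
  ring

lemma Real.sign_eq_one_iff {r : ℝ} : Real.sign r = 1 ↔ 0 < r := by
  rcases lt_trichotomy r 0 with h | rfl | h
  · rw [Real.sign_of_neg h]
    constructor <;> intro <;> linarith
  · simp
  · simp [Real.sign_of_pos h, h]

lemma Real.sign_eq_neg_one_iff {r : ℝ} : Real.sign r = -1 ↔ r < 0 := by
  rw [← neg_pos, ← Real.sign_eq_one_iff, Real.sign_neg, neg_eq_iff_eq_neg]

lemma definesSignPattern_iff (a b c d : ℝ) :
    definesSignPattern ((X - 1) ^ 4 * (X ^ 4 + C a * X ^ 3 + C b * X ^ 2 + C c * X + C d))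
        ![1, -1, -1, 1, -1, 1, -1, 1, 1] ↔
      a - 4 < 0 ∧ b - 4 * a + 6 < 0 ∧ 0 < c - 4 * b + 6 * a - 4 ∧
        d - 4 * c + 6 * b - 4 * a + 1 < 0 ∧ 0 < -4 * d + 6 * c - 4 * b + a ∧
        6 * d - 4 * c + b < 0 ∧ 0 < -4 * d + c ∧ 0 < d := by
  rw [X_sub_one_pow_four_mul]
  simp [definesSignPattern, Fin.forall_fin_succ, coeff_X, coeff_C, coeff_X_pow,
    Real.sign_eq_one_iff, Real.sign_eq_neg_one_iff, -map_add, -map_sub, -map_mul, -map_neg]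

/-- If `U = (x−1)⁴ V`, with `V` monic of degree 4 without real roots, defines
the sign pattern (+,−,−,+,−,+,−,+,+), then for some `t > 0` the polynomial
`U + t·x(x−1)⁴` has the form `(x−1)⁴ (x² + Sx + S²/4)(x² + Mx + N)` with
`S > 0`, `N ≥ M²/4`, and defines the sign pattern (+,−,−,+,−,+,−,+,+). -/
theorem stmt13 (U V : Polynomial ℝ)
    (hVmonic : V.Monic) (hVdeg : V.degree = 4) (hVroots : ∀ x : ℝ, V.eval x ≠ 0)
    (hU : U = (X - 1) ^ 4 * V)
    (hpat : definesSignPattern U ![1, -1, -1, 1, -1, 1, -1, 1, 1]) :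
    ∃ t S M N : ℝ, 0 < t ∧ 0 < S ∧ M ^ 2 / 4 ≤ N ∧
      U + C t * X * (X - 1) ^ 4 =
        (X - 1) ^ 4 * (X ^ 2 + C S * X + C (S ^ 2 / 4)) *
          (X ^ 2 + C M * X + C N) ∧
      definesSignPattern (U + C t * X * (X - 1) ^ 4)
        ![1, -1, -1, 1, -1, 1, -1, 1, 1] := by
  obtain ⟨a, b, c, d, rfl⟩ : ∃ a b c d : ℝ,
      V = X ^ 4 + C a * X ^ 3 + C b * X ^ 2 + C c * X + C d := by
    have hnat : V.natDegree = 4 := natDegree_eq_of_degree_eq_some hVdeg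
    refine ⟨V.coeff 3, V.coeff 2, V.coeff 1, V.coeff 0, ?_⟩
    conv_lhs => rw [hVmonic.as_sum, hnat]
    simp only [Finset.sum_range_succ, Finset.sum_range_zero]
    ring
  subst hU
  rw [definesSignPattern_iff] at hpat
  obtain ⟨h7, h6, h5, h4, h3, h2, h1, hd⟩ := hpat
  have hpos : ∀ x : ℝ, 0 < x ^ 4 + a * x ^ 3 + b * x ^ 2 + c * x + d := by
    intro x
    by_contra! hx
    obtain ⟨z, hz⟩ := mem_range_of_exists_le_of_exists_ge
      (f := fun x : ℝ => x ^ 4 + a * x ^ 3 + b * x ^ 2 + c * x + d) (c := 0) (by fun_prop)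
      ⟨x, hx⟩ ⟨0, by simpa using hd.le⟩
    exact hVroots z (by simpa using hz)
  obtain ⟨t, y, ht, hy, hroot, hnonneg⟩ := exists_tangent_of_pos hpos
  obtain ⟨M, N, hMN, ha, hb, hc, hdN⟩ := exists_factor_of_nonneg hy hd hroot hnonneg
  have hsum : (X - 1 : ℝ[X]) ^ 4 * (X ^ 4 + C a * X ^ 3 + C b * X ^ 2 + C c * X + C d) +
      C t * X * (X - 1) ^ 4 =
      (X - 1) ^ 4 * (X ^ 4 + C a * X ^ 3 + C b * X ^ 2 + C (c + t) * X + C d) := by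
    rw [map_add]
    ring
  refine ⟨t, 2 * y, M, N, ht, by positivity, hMN, ?_, ?_⟩
  · have hsq : (2 * y) ^ 2 / 4 = y ^ 2 := by ring
    rw [hsum, hsq, hc, ha, hb, hdN]
    simp only [map_add, map_mul, map_pow, map_ofNat]
    ring
  · rw [hsum, definesSignPattern_iff]
    refine ⟨h7, h6, ?_, ?_, ?_, ?_, ?_, hd⟩ <;> linarith
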